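/- Let G be a reductive group over a field k acting on a rational representation V, and suppose w ∈ V(k) has open orbit U = Gw with reductive (hence smooth) stabilizer G_w. Then the complement V \ U is either empty or a hypersurface, i.e., every irreducible component of V \ U has codimension one in V. -/

import Mathlib

/-!
STATEMENT 8 (Theorem (1) of the paper): Let `G = Spec R` be a reductive group over a field
`k` acting on a rational representation `V = kⁿ` via the coaction `ρ`, and suppose
`w ∈ V(k)` has open orbit `U = Gw` with reductive (hence smooth) stabilizer `G_w`
(presented by a Hopf quotient `π : R → S` with kernel the stabilizer ideal).  Then the
complement `V \ U` is either empty or a hypersurface: every irreducible component of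
`V \ U` has codimension one in `V`.
-/

open TensorProduct AlgebraicGeometry CategoryTheory TopologicalSpace

section Framework

variable {k : Type} [Field k] {R : Type} [CommRing R] [HopfAlgebra k R]

/-- `ρ : V →ₗ V ⊗ R` is a (right) comodule structure over the Hopf algebra `R`, i.e. a
rational representation of the affine group scheme `G = Spec R` on `V`. -/
def IsCoaction {V : Type} [AddCommGroup V] [Module k V] (ρ : V →ₗ[k] V ⊗[k] R) : Prop :=
  (∀ v, (TensorProduct.rid k V)
      ((TensorProduct.map LinearMap.id (Coalgebra.counit (R := k) (A := R))) (ρ v)) = v) ∧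
  (∀ v, (TensorProduct.assoc k V R R)
      ((TensorProduct.map ρ (LinearMap.id : R →ₗ[k] R)) (ρ v)) =
    (TensorProduct.map LinearMap.id (Coalgebra.comul (R := k) (A := R))) (ρ v))

variable {n : ℕ}

/-- The matrix coefficient: the regular function `g ↦ (g • v)_i` on `G = Spec R`. -/
noncomputable def matCoef (ρ : (Fin n → k) →ₗ[k] (Fin n → k) ⊗[k] R)
    (v : Fin n → k) (i : Fin n) : R :=
  (TensorProduct.lid k R) ((TensorProduct.map (LinearMap.proj i) LinearMap.id) (ρ v))

/-- The comorphism `k[V] → R` of the orbit map `G → V`, `g ↦ g • w`. -/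
noncomputable def orbitHom (ρ : (Fin n → k) →ₗ[k] (Fin n → k) ⊗[k] R) (w : Fin n → k) :
    MvPolynomial (Fin n) k →ₐ[k] R :=
  MvPolynomial.aeval (fun i => matCoef ρ w i)

/-- The orbit map `G = Spec R ⟶ V = Spec k[x₁,…,xₙ]` of the point `w`; its set-theoretic
image is the orbit `Gw`. -/
noncomputable def orbitMap (ρ : (Fin n → k) →ₗ[k] (Fin n → k) ⊗[k] R) (w : Fin n → k) :
    Spec (CommRingCat.of R) ⟶ Spec (CommRingCat.of (MvPolynomial (Fin n) k)) :=
  Spec.map (CommRingCat.ofHom (orbitHom ρ w).toRingHom)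

/-- The ideal of the scheme-theoretic stabilizer `G_w` of `w` in `G = Spec R`: it is
generated by the functions `g ↦ (g • w)_i − w_i`, so `G_w = Spec (R ⧸ stabIdeal ρ w)`. -/
noncomputable def stabIdeal (ρ : (Fin n → k) →ₗ[k] (Fin n → k) ⊗[k] R) (w : Fin n → k) :
    Ideal R :=
  Ideal.span {x | ∃ i, x = matCoef ρ w i - algebraMap k R (w i)}

/-- The action of a `k`-rational point `g : R →ₐ[k] k` of `G` on `V = kⁿ`. -/
noncomputable def ptAct (ρ : (Fin n → k) →ₗ[k] (Fin n → k) ⊗[k] R)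
    (g : R →ₐ[k] k) (v : Fin n → k) : Fin n → k :=
  (TensorProduct.rid k (Fin n → k)) ((TensorProduct.map LinearMap.id g.toLinearMap) (ρ v))

/-- The induced coaction of `R` on the coordinate ring `k[V] = k[x₁,…,xₙ]`, i.e. the
comorphism of the action morphism `V × G → V`. -/
noncomputable def coactPoly (ρ : (Fin n → k) →ₗ[k] (Fin n → k) ⊗[k] R) :
    MvPolynomial (Fin n) k →ₐ[k] (MvPolynomial (Fin n) k) ⊗[k] R :=
  MvPolynomial.aeval (fun i => ∑ j, (MvPolynomial.X j) ⊗ₜ[k] (matCoef ρ (Pi.single j 1) i))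

/-- The `k`-rational point of affine `n`-space corresponding to `x : kⁿ`. -/
noncomputable def ratPoint (x : Fin n → k) :
    Spec (CommRingCat.of (MvPolynomial (Fin n) k)) :=
  ⟨RingHom.ker (MvPolynomial.eval x), RingHom.ker_isPrime _⟩

/-- An affine group scheme `G = Spec R` over `k`, given by a finitely generated
commutative Hopf algebra `R`, is reductive: it is smooth over `k` and geometrically
reductive in the sense of Mumford–Haboush (for every finite-dimensional rational
representation and every nonzero invariant vector `w` there is a nonconstant homogeneous
invariant polynomial not vanishing at `w`); by Haboush's theorem geometric reductivity is
equivalent to reductivity. -/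
def IsReductive (k R : Type) [Field k] [CommRing R] [HopfAlgebra k R] : Prop :=
  Algebra.FiniteType k R ∧ Algebra.Smooth k R ∧
  ∀ (n : ℕ) (ρ : (Fin n → k) →ₗ[k] (Fin n → k) ⊗[k] R), IsCoaction ρ →
    ∀ w : Fin n → k, w ≠ 0 → ρ w = w ⊗ₜ[k] (1 : R) →
      ∃ (f : MvPolynomial (Fin n) k) (d : ℕ), 0 < d ∧ f.IsHomogeneous d ∧
        coactPoly ρ f = f ⊗ₜ[k] (1 : R) ∧ MvPolynomial.eval w f ≠ 0

/-- `π : R → S` presents `Spec S` as a closed subgroup scheme of `Spec R`: it is a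
surjective algebra map compatible with the comultiplications (a Hopf algebra quotient). -/
def IsHopfQuotient {S : Type} [CommRing S] [HopfAlgebra k S] (π : R →ₐ[k] S) : Prop :=
  Function.Surjective π ∧
    ∀ x : R, Coalgebra.comul (R := k) (π x) =
      (TensorProduct.map π.toLinearMap π.toLinearMap) (Coalgebra.comul (R := k) x)

end Framework

/-- A closed subset `C` of a topological space is of pure codimension one if every
irreducible component of `C` (maximal irreducible closed subset contained in `C`) has
coheight one in the poset of irreducible closed subsets of the ambient space. -/
def PureCodimOne {X : Type} [TopologicalSpace X] (C : Set X) : Prop :=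
  ∀ Z : IrreducibleCloseds X, Z.carrier ⊆ C →
    (∀ Z' : IrreducibleCloseds X, Z'.carrier ⊆ C → Z ≤ Z' → Z' = Z) →
    Order.coheight Z = 1

section MatrixCoefficients

open WithConv

variable {k : Type} [Field k] {R : Type} [CommRing R] [HopfAlgebra k R] {n : ℕ}
  {C : Type} [CommRing C] [Algebra k C]

lemma coaction_eq_sum_single_tmul_matCoef (ρ : (Fin n → k) →ₗ[k] (Fin n → k) ⊗[k] R)
    (v : Fin n → k) : ρ v = ∑ i, Pi.single i 1 ⊗ₜ[k] matCoef ρ v i := by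
  have key : ∀ z : (Fin n → k) ⊗[k] R, z = ∑ i, (Pi.single i 1 : Fin n → k) ⊗ₜ[k]
      (TensorProduct.lid k R (TensorProduct.map (LinearMap.proj i) LinearMap.id z)) := by
    intro z
    induction z with
    | zero => simp
    | add x y hx hy =>
      simp only [map_add, tmul_add, Finset.sum_add_distrib]
      rw [← hx, ← hy]
    | tmul x r =>
      simp only [map_tmul, LinearMap.proj_apply, LinearMap.id_apply, lid_tmul,
        ← smul_tmul, ← TensorProduct.sum_tmul]
      congr 1
      ext i
      simp [Finset.sum_apply, Pi.single_apply]
  exact key _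

/-- The matrix coefficients of the coaction in the standard basis. -/
noncomputable def coefMatrix (ρ : (Fin n → k) →ₗ[k] (Fin n → k) ⊗[k] R) :
    Matrix (Fin n) (Fin n) R :=
  Matrix.of fun i j => matCoef ρ (Pi.single j 1) i

lemma comul_matCoef {ρ : (Fin n → k) →ₗ[k] (Fin n → k) ⊗[k] R} (hρ : IsCoaction ρ)
    (v : Fin n → k) (i : Fin n) :
    Coalgebra.comul (R := k) (matCoef ρ v i) = ∑ j, coefMatrix ρ i j ⊗ₜ[k] matCoef ρ v j := by
  have h := congrArg (fun z => TensorProduct.lid k (R ⊗[k] R)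
    (TensorProduct.map (LinearMap.proj i) LinearMap.id z)) (hρ.2 v)
  rw [coaction_eq_sum_single_tmul_matCoef ρ v] at h
  simp only [map_sum, map_tmul, LinearMap.id_apply] at h
  simp only [LinearMap.proj_apply, lid_tmul, Pi.single_apply, ite_smul, one_smul,
    zero_smul, Finset.sum_ite_eq, Finset.mem_univ, if_true] at h
  rw [← h]
  refine Finset.sum_congr rfl fun j _ => ?_
  rw [coaction_eq_sum_single_tmul_matCoef ρ (Pi.single j 1)]
  simp only [TensorProduct.sum_tmul, map_sum, assoc_tmul, map_tmul, LinearMap.proj_apply,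
    LinearMap.id_apply, lid_tmul, Pi.single_apply, ite_smul, one_smul, zero_smul,
    Finset.sum_ite_eq, Finset.mem_univ, if_true]
  rfl

lemma counit_matCoef {ρ : (Fin n → k) →ₗ[k] (Fin n → k) ⊗[k] R} (hρ : IsCoaction ρ)
    (v : Fin n → k) (i : Fin n) : Coalgebra.counit (R := k) (matCoef ρ v i) = v i := by
  have h := congrFun (hρ.1 v) i
  rw [coaction_eq_sum_single_tmul_matCoef ρ v] at h
  simpa [Finset.sum_apply, Pi.single_apply] using h

lemma convMul_matCoef {ρ : (Fin n → k) →ₗ[k] (Fin n → k) ⊗[k] R} (hρ : IsCoaction ρ)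
    (f g : WithConv (R →ₐ[k] C)) (v : Fin n → k) (i : Fin n) :
    (f * g) (matCoef ρ v i) = ∑ j, f (coefMatrix ρ i j) * g (matCoef ρ v j) := by
  rw [AlgHom.convMul_apply, comul_matCoef hρ]
  simp

lemma convOne_matCoef {ρ : (Fin n → k) →ₗ[k] (Fin n → k) ⊗[k] R} (hρ : IsCoaction ρ)
    (v : Fin n → k) (i : Fin n) :
    (1 : WithConv (R →ₐ[k] C)) (matCoef ρ v i) = algebraMap k C (v i) := by
  rw [AlgHom.convOne_apply, counit_matCoef hρ]

/-- The matrix coefficients at a point `f` of the group scheme. -/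
noncomputable def pointMatrix (ρ : (Fin n → k) →ₗ[k] (Fin n → k) ⊗[k] R)
    (f : WithConv (R →ₐ[k] C)) : Matrix (Fin n) (Fin n) C :=
  (coefMatrix ρ).map f

lemma pointMatrix_mul {ρ : (Fin n → k) →ₗ[k] (Fin n → k) ⊗[k] R} (hρ : IsCoaction ρ)
    (f g : WithConv (R →ₐ[k] C)) :
    pointMatrix ρ (f * g) = pointMatrix ρ f * pointMatrix ρ g := by
  ext i j
  exact convMul_matCoef hρ f g _ i

lemma pointMatrix_one {ρ : (Fin n → k) →ₗ[k] (Fin n → k) ⊗[k] R} (hρ : IsCoaction ρ) :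
    pointMatrix ρ (1 : WithConv (R →ₐ[k] C)) = 1 := by
  ext i j
  refine (convOne_matCoef hρ _ i).trans ?_
  simp [Pi.single_apply, Matrix.one_apply, apply_ite (algebraMap k C)]

end MatrixCoefficients

section LinearSubstitution

variable {k : Type} [Field k] {R : Type} [CommRing R] [Algebra k R] {n : ℕ}

/-- The `R`-linear substitution of variables `X i ↦ ∑ j, X j ⊗ P i j` on `k[X] ⊗ R`. -/
noncomputable def linSubst (P : Matrix (Fin n) (Fin n) R) :
    MvPolynomial (Fin n) k ⊗[k] R →ₐ[k] MvPolynomial (Fin n) k ⊗[k] R :=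
  Algebra.TensorProduct.lift
    (MvPolynomial.aeval fun i => ∑ j, MvPolynomial.X j ⊗ₜ[k] P i j)
    Algebra.TensorProduct.includeRight (fun _ _ => .all _ _)

lemma linSubst_comp (P Q : Matrix (Fin n) (Fin n) R) :
    (linSubst (k := k) P).comp (linSubst Q) = linSubst (Q * P) := by
  ext i
  · simp only [linSubst, AlgHom.comp_apply, Algebra.TensorProduct.includeLeft_apply,
      Algebra.TensorProduct.lift_tmul, MvPolynomial.aeval_X, map_one, mul_one, map_sum,
      Algebra.TensorProduct.includeRight_apply, Finset.sum_mul, Matrix.mul_apply,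
      Algebra.TensorProduct.tmul_mul_tmul, TensorProduct.tmul_sum]
    rw [Finset.sum_comm]
    simp [mul_comm]
  · simp [linSubst]

lemma linSubst_one : linSubst (k := k) (1 : Matrix (Fin n) (Fin n) R) = AlgHom.id k _ := by
  ext i
  · simp [linSubst, Matrix.one_apply, TensorProduct.tmul_ite]
  · simp [linSubst]

lemma isSMulRegular_linSubst_tmul_one {P Q : Matrix (Fin n) (Fin n) R} (hPQ : P * Q = 1)
    (hQP : Q * P = 1) {g : MvPolynomial (Fin n) k} (hg : g ≠ 0) :
    IsSMulRegular (MvPolynomial (Fin n) k ⊗[k] R) (linSubst (k := k) P (g ⊗ₜ[k] (1 : R))) := by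
  have inv₁ (x) : linSubst (k := k) Q (linSubst (k := k) P x) = x := by
    rw [← AlgHom.comp_apply, linSubst_comp, hPQ, linSubst_one, AlgHom.id_apply]
  have inv₂ (x) : linSubst (k := k) P (linSubst (k := k) Q x) = x := by
    rw [← AlgHom.comp_apply, linSubst_comp, hQP, linSubst_one, AlgHom.id_apply]
  have hreg : IsSMulRegular (MvPolynomial (Fin n) k ⊗[k] R) g :=
    Module.Flat.isSMulRegular_of_nonZeroDivisors
      (M := MvPolynomial (Fin n) k ⊗[k] R) (mem_nonZeroDivisors_of_ne_zero hg)
  intro x y hxy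
  have h := congrArg (linSubst (k := k) Q) hxy
  simp only [smul_eq_mul, map_mul, inv₁] at h
  have h' : linSubst (k := k) Q x = linSubst (k := k) Q y := hreg (by
    have hs (z : MvPolynomial (Fin n) k ⊗[k] R) : g • z = g ⊗ₜ[k] (1 : R) * z :=
      Algebra.smul_def g z
    simpa only [hs] using h)
  rw [← inv₂ x, h', inv₂]

end LinearSubstitution

section Orbit

open WithConv

lemma flat_of_field_of_injective {A L : Type} [CommRing A] [IsDomain A] [Field L] [Algebra A L]
    (h : Function.Injective (algebraMap A L)) : Module.Flat A L := by
  let : Algebra (FractionRing A) L := (IsFractionRing.lift h).toAlgebra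
  have : IsScalarTower A (FractionRing A) L :=
    .of_algebraMap_eq fun x => (IsFractionRing.lift_algebraMap h x).symm
  exact Module.Flat.trans A (FractionRing A) L

lemma isRegular_map_of_flat {k A B R : Type} [Field k] [CommRing A] [CommRing B] [CommRing R]
    [Algebra k A] [Algebra k B] [Algebra k R] [Algebra A B] [IsScalarTower k A B]
    [Module.Flat A B] {d : A ⊗[k] R} (hd : IsSMulRegular (A ⊗[k] R) d) {z : B ⊗[k] R}
    (hz : Algebra.TensorProduct.map (IsScalarTower.toAlgHom k A B) (AlgHom.id k R) d * z = 0) :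
    z = 0 := by
  let e := Algebra.TensorProduct.cancelBaseChange k A A B R
  have he : ∀ d : A ⊗[k] R, e (1 ⊗ₜ d) =
      Algebra.TensorProduct.map (IsScalarTower.toAlgHom k A B) (AlgHom.id k R) d := by
    intro d
    induction d with
    | zero => simp
    | add x y hx hy => rw [tmul_add, map_add, map_add, hx, hy]
    | tmul a r =>
      simp [e, Algebra.smul_def]
  have hinj : Function.Injective (LinearMap.lTensor B (LinearMap.mulLeft A d)) :=
    Module.Flat.lTensor_preserves_injective_linearMap _ hd
  have hmul : ∀ x, LinearMap.lTensor B (LinearMap.mulLeft A d) x = (1 ⊗ₜ d) * x := by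
    intro x
    induction x with
    | zero => simp
    | add x y hx hy => rw [map_add, mul_add, hx, hy]
    | tmul a r => simp
  rw [← he, ← e.apply_symm_apply z, ← map_mul, ← hmul, map_eq_zero_iff e e.injective,
    map_eq_zero_iff _ hinj] at hz
  simpa using hz

variable {k : Type} [Field k] {R : Type} [CommRing R] [HopfAlgebra k R] {n : ℕ}
  {C : Type} [CommRing C] [Algebra k C]

/-- The inverse of a point of an affine group scheme with values in an arbitrary algebra. -/
noncomputable def pointInv (f : WithConv (R →ₐ[k] C)) : WithConv (R →ₐ[k] C) :=
  toConv (f.ofConv.comp (HopfAlgebra.antipodeAlgHom k R))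

lemma comp_convOne {D : Type} [CommRing D] [Algebra k D] (f : C →ₐ[k] D) :
    f.comp (1 : WithConv (R →ₐ[k] C)).ofConv = (1 : WithConv (R →ₐ[k] D)).ofConv := by
  ext x
  exact f.commutes _

lemma pointInv_mul_self (f : WithConv (R →ₐ[k] C)) : pointInv f * f = 1 := by
  have h := AlgHom.comp_convMul_distrib f.ofConv
    (toConv (HopfAlgebra.antipodeAlgHom k R)) (toConv (AlgHom.id k R))
  rw [AlgHom.antipode_id_cancel, comp_convOne] at h
  exact (ofConv_injective h).symm

lemma mul_pointInv_self (f : WithConv (R →ₐ[k] C)) : f * pointInv f = 1 := by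
  have h := AlgHom.comp_convMul_distrib f.ofConv
    (toConv (AlgHom.id k R)) (toConv (AlgHom.id k R))⁻¹
  rw [mul_inv_cancel, comp_convOne] at h
  exact (ofConv_injective h).symm

lemma coactPoly_eq_linSubst (ρ : (Fin n → k) →ₗ[k] (Fin n → k) ⊗[k] R)
    (a : MvPolynomial (Fin n) k) :
    coactPoly ρ a = linSubst (k := k) (coefMatrix ρ) (a ⊗ₜ[k] (1 : R)) := by
  rw [linSubst, Algebra.TensorProduct.lift_tmul, map_one, mul_one]
  rfl

lemma convMul_orbitHom {ρ : (Fin n → k) →ₗ[k] (Fin n → k) ⊗[k] R} (hρ : IsCoaction ρ)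
    (w : Fin n → k) (f g : WithConv (R →ₐ[k] C)) (a : MvPolynomial (Fin n) k) :
    (f * g) (orbitHom ρ w a) = Algebra.TensorProduct.lift (g.ofConv.comp (orbitHom ρ w)) f.ofConv
      (fun _ _ => .all _ _) (coactPoly ρ a) := by
  suffices h : (f * g).ofConv.comp (orbitHom ρ w) =
      (Algebra.TensorProduct.lift (g.ofConv.comp (orbitHom ρ w)) f.ofConv
        (fun _ _ => .all _ _)).comp (coactPoly ρ) from DFunLike.congr_fun h a
  ext i
  simp only [AlgHom.comp_apply, orbitHom, MvPolynomial.aeval_X, coactPoly, map_sum,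
    Algebra.TensorProduct.lift_tmul]
  exact (convMul_matCoef hρ f g w i).trans (Finset.sum_congr rfl fun j _ => mul_comm _ _)

/-- If some field-valued point of the group maps to the generic point of the representation, then
the coordinate ring of the group is torsion-free over that of the representation. -/
lemma eq_zero_of_orbitHom_mul_eq_zero {ρ : (Fin n → k) →ₗ[k] (Fin n → k) ⊗[k] R}
    (hρ : IsCoaction ρ) {w : Fin n → k} {L : Type} [Field L] [Algebra k L] (y : R →ₐ[k] L)
    (hy : Function.Injective (y.comp (orbitHom ρ w))) {g : MvPolynomial (Fin n) k} (hg : g ≠ 0)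
    {r : R} (hr : orbitHom ρ w g * r = 0) : r = 0 := by
  let : Algebra (MvPolynomial (Fin n) k) L := (y.comp (orbitHom ρ w)).toRingHom.toAlgebra
  have : IsScalarTower k (MvPolynomial (Fin n) k) L :=
    .of_algebraMap_eq fun x => ((y.comp (orbitHom ρ w)).commutes x).symm
  have : Module.Flat (MvPolynomial (Fin n) k) L := flat_of_field_of_injective hy
  let pL : WithConv (R →ₐ[k] L ⊗[k] R) := toConv (Algebra.TensorProduct.includeLeft.comp y)
  let pR : WithConv (R →ₐ[k] L ⊗[k] R) := toConv Algebra.TensorProduct.includeRight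
  have h₁ : (pR * pL) (orbitHom ρ w g) * (pR * pL) r = 0 := by
    rw [← map_mul, hr, map_zero]
  have h₂ : (pR * pL) (orbitHom ρ w g) = Algebra.TensorProduct.map
      (IsScalarTower.toAlgHom k (MvPolynomial (Fin n) k) L) (AlgHom.id k R) (coactPoly ρ g) := by
    rw [convMul_orbitHom hρ]
    refine DFunLike.congr_fun ?_ _
    ext i
    · simp [pL]
      rfl
    · simp [pR]
  have hP : pointMatrix ρ (toConv (AlgHom.id k R)) = coefMatrix ρ := rfl
  have hreg := isSMulRegular_linSubst_tmul_one (k := k)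
    (P := pointMatrix ρ (toConv (AlgHom.id k R))) (Q := pointMatrix ρ (toConv (AlgHom.id k R))⁻¹)
    (by rw [← pointMatrix_mul hρ, mul_inv_cancel, pointMatrix_one hρ])
    (by rw [← pointMatrix_mul hρ, inv_mul_cancel, pointMatrix_one hρ]) hg
  rw [hP, ← coactPoly_eq_linSubst] at hreg
  rw [h₂] at h₁
  have h₃ : (pR * pL) r = 0 := isRegular_map_of_flat hreg h₁
  let μ : L ⊗[k] R →ₐ[k] L ⊗[k] R := Algebra.TensorProduct.lift
    Algebra.TensorProduct.includeLeft (pR * pointInv pL).ofConv (fun _ _ => .all _ _)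
  have hμL : toConv (μ.comp pL.ofConv) = pL := by
    ext x
    simp [μ, pL]
  have hμR : toConv (μ.comp pR.ofConv) = pR * pointInv pL := by
    ext x
    simp [μ, pR]
  have h₄ : μ ((pR * pL) r) = pR r := by
    have := DFunLike.congr_fun (AlgHom.comp_convMul_distrib μ pR pL) r
    rw [hμL, hμR, mul_assoc, pointInv_mul_self, mul_one] at this
    exact this
  rw [h₃, map_zero] at h₄
  exact Algebra.TensorProduct.includeRight_injective
    (FaithfulSMul.algebraMap_injective k L) (h₄.symm.trans (map_zero _).symm)

/-- A function on `G` that is invariant under the stabilizer takes equal values at any two points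
with the same image under the orbit map. -/
lemma tmul_one_eq_one_tmul_of_invariant [Algebra (MvPolynomial (Fin n) k) R]
    [IsScalarTower k (MvPolynomial (Fin n) k) R]
    {ρ : (Fin n → k) →ₗ[k] (Fin n → k) ⊗[k] R} (hρ : IsCoaction ρ) {w : Fin n → k}
    (hφ : ∀ a, algebraMap (MvPolynomial (Fin n) k) R a = orbitHom ρ w a)
    {S : Type} [CommRing S] [Algebra k S] {π : R →ₐ[k] S} (hπ : Function.Surjective π)
    (hker : RingHom.ker π.toRingHom = stabIdeal ρ w) {b : R}
    (hb : Algebra.TensorProduct.map (AlgHom.id k R) π (Coalgebra.comul (R := k) b) =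
      b ⊗ₜ[k] (1 : S)) :
    b ⊗ₜ[MvPolynomial (Fin n) k] (1 : R) = 1 ⊗ₜ b := by
  let P := R ⊗[MvPolynomial (Fin n) k] R
  let pL : WithConv (R →ₐ[k] P) := toConv Algebra.TensorProduct.includeLeft
  let pR : WithConv (R →ₐ[k] P) :=
    toConv (Algebra.TensorProduct.includeRight.restrictScalars k)
  let θ : R ⊗[k] R →ₐ[k] P := Algebra.TensorProduct.lift pL.ofConv (pointInv pL * pR).ofConv
    (fun _ _ => .all _ _)
  have hagree (j : Fin n) : pR (matCoef ρ w j) = pL (matCoef ρ w j) := by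
    have hj : matCoef ρ w j = algebraMap (MvPolynomial (Fin n) k) R (.X j) := by
      simp [hφ, orbitHom]
    change 1 ⊗ₜ matCoef ρ w j = matCoef ρ w j ⊗ₜ 1
    rw [hj, Algebra.algebraMap_eq_smul_one, smul_tmul]
  have hstab (i : Fin n) : (pointInv pL * pR) (matCoef ρ w i) = algebraMap k P (w i) := by
    rw [convMul_matCoef hρ]
    simp only [hagree]
    rw [← convMul_matCoef hρ, pointInv_mul_self, convOne_matCoef hρ]
  have hle : RingHom.ker (Algebra.TensorProduct.map (AlgHom.id k R) π) ≤ RingHom.ker θ := by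
    have hker' : RingHom.ker π = stabIdeal ρ w := hker
    rw [Algebra.TensorProduct.lTensor_ker _ hπ, hker', stabIdeal, Ideal.map_span, Ideal.span_le]
    rintro _ ⟨_, ⟨i, rfl⟩, rfl⟩
    change θ (1 ⊗ₜ _) = 0
    simp only [θ, Algebra.TensorProduct.lift_tmul, map_one, one_mul, map_sub, AlgHom.commutes]
    exact sub_eq_zero.mpr (hstab i)
  have hmem : Coalgebra.comul (R := k) b - b ⊗ₜ 1 ∈ RingHom.ker θ := by
    apply hle
    rw [RingHom.mem_ker, map_sub, hb]
    simp
  have hcomul : θ (Coalgebra.comul (R := k) b) = pR b := by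
    rw [← AlgHom.convMul_apply, ← mul_assoc, mul_pointInv_self, one_mul]
  rw [RingHom.mem_ker, map_sub, hcomul, sub_eq_zero] at hmem
  refine Eq.trans ?_ hmem.symm
  simp [θ, pL, P]

/-- A function on `G` that is invariant under the stabilizer descends to a rational function on
the representation. -/
lemma exists_orbitHom_mul_eq_of_invariant
    {ρ : (Fin n → k) →ₗ[k] (Fin n → k) ⊗[k] R} (hρ : IsCoaction ρ) {w : Fin n → k}
    {L : Type} [Field L] [Algebra k L] (y : R →ₐ[k] L)
    (hy : Function.Injective (y.comp (orbitHom ρ w)))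
    {S : Type} [CommRing S] [Algebra k S] {π : R →ₐ[k] S} (hπ : Function.Surjective π)
    (hker : RingHom.ker π.toRingHom = stabIdeal ρ w) {b : R}
    (hb : Algebra.TensorProduct.map (AlgHom.id k R) π (Coalgebra.comul (R := k) b) =
      b ⊗ₜ[k] (1 : S)) :
    ∃ p q : MvPolynomial (Fin n) k, q ≠ 0 ∧ IsRelPrime p q ∧
      orbitHom ρ w q * b = orbitHom ρ w p := by
  let A := MvPolynomial (Fin n) k
  let K := FractionRing A
  let _ : Algebra A R := (orbitHom ρ w).toRingHom.toAlgebra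
  have _ : IsScalarTower k A R :=
    .of_algebraMap_eq fun x => ((orbitHom ρ w).commutes x).symm
  let _ : Algebra A L := (y.comp (orbitHom ρ w)).toRingHom.toAlgebra
  let _ : Algebra K L := (IsFractionRing.lift (K := K) (g := algebraMap A L) hy).toAlgebra
  have _ : IsScalarTower A K L :=
    .of_algebraMap_eq fun x => (IsFractionRing.lift_algebraMap (K := K) hy x).symm
  let yA : R →ₗ[A] L :=
    { toFun := y
      map_add' := map_add y
      map_smul' := fun a x => (by
        rw [Algebra.smul_def, map_mul]
        exact (Algebra.smul_def a (y x)).symm) }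
  obtain ⟨s, hs⟩ := LinearMap.exists_leftInverse_of_injective (Algebra.linearMap K L)
    (LinearMap.ker_eq_bot.mpr (algebraMap K L).injective)
  let ℓ : R →ₗ[A] K := (s.restrictScalars A).comp yA
  have hℓ : ℓ 1 = 1 := by
    have h1 := LinearMap.congr_fun hs 1
    simpa [ℓ, yA] using h1
  have key := congrArg (ℓ.rTensor R)
    (tmul_one_eq_one_tmul_of_invariant hρ (w := w) (fun _ => rfl) hπ hker hb)
  rw [LinearMap.rTensor_tmul, LinearMap.rTensor_tmul, hℓ] at key
  obtain ⟨p, q, hpq, hx⟩ := IsFractionRing.exists_reduced_fraction A (ℓ b)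
  have hq : (q : A) ≠ 0 := nonZeroDivisors.ne_zero q.2
  refine ⟨p, q, hq, hpq, ?_⟩
  have hx' : (q : A) • ℓ b = p • 1 := by
    rw [← hx, Algebra.smul_def, IsLocalization.mk'_spec', Algebra.algebraMap_eq_smul_one]
  have hzero : TensorProduct.mk A K R 1 (orbitHom ρ w q * b - orbitHom ρ w p) = 0 := by
    have h1 : orbitHom ρ w q * b = (q : A) • b := (Algebra.smul_def _ _).symm
    have h2 : orbitHom ρ w p = p • (1 : R) := Algebra.algebraMap_eq_smul_one p
    rw [h1, h2, map_sub, map_smul, map_smul, TensorProduct.mk_apply, TensorProduct.mk_apply, ← key,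
      smul_tmul', hx', smul_tmul', sub_self]
  obtain ⟨c, hc⟩ := (IsLocalizedModule.eq_zero_iff (nonZeroDivisors A) _).mp hzero
  refine sub_eq_zero.mp (eq_zero_of_orbitHom_mul_eq_zero hρ y hy
    (nonZeroDivisors.ne_zero c.2) (r := _) ?_)
  exact (Algebra.smul_def (c : A) _).symm.trans hc

end Orbit

section Slices

variable {k : Type} [Field k] {M S : Type} [AddCommGroup M] [Module k M]

/-- Contraction of the second tensor factor with a linear functional. -/
noncomputable def sliceRight [AddCommGroup S] [Module k S] (M : Type) [AddCommGroup M]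
    [Module k M] (φ : Module.Dual k S) : M ⊗[k] S →ₗ[k] M :=
  (TensorProduct.rid k M).toLinearMap ∘ₗ φ.lTensor M

@[simp]
lemma sliceRight_tmul [AddCommGroup S] [Module k S] (φ : Module.Dual k S) (m : M) (s : S) :
    sliceRight M φ (m ⊗ₜ s) = φ s • m := by
  simp [sliceRight]

lemma comp_sliceRight [AddCommGroup S] [Module k S] {M' : Type} [AddCommGroup M'] [Module k M']
    (f : M →ₗ[k] M') (φ : Module.Dual k S) (z : M ⊗[k] S) :
    f (sliceRight M φ z) = sliceRight M' φ (f.rTensor S z) := by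
  induction z with
  | zero => simp
  | add x y hx hy => simp only [map_add, hx, hy]
  | tmul m s => simp

/-- Every tensor is a sum `∑ e l ⊗ t l` with `e` linearly independent and consisting of
contractions of the tensor. -/
lemma exists_eq_sum_sliceRight_tmul [AddCommGroup S] [Module k S] (z : M ⊗[k] S) :
    ∃ (N : ℕ) (e : Fin N → M) (φ : Fin N → Module.Dual k S) (t : Fin N → S)
      (g : M →ₗ[k] Fin N → k), (∀ j, g (e j) = Pi.single j 1) ∧
      (∀ j, e j = sliceRight M (φ j) z) ∧ z = ∑ l, e l ⊗ₜ[k] t l := by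
  classical
  let 𝒞 := Module.Basis.ofVectorSpace k S
  let x := equivFinsuppOfBasisRight (M := M) 𝒞 z
  have hx (a) : x a = sliceRight M (𝒞.coord a) z := equivFinsuppOfBasisRight_apply 𝒞 z a
  have hz : z = ∑ a ∈ x.support, x a ⊗ₜ[k] 𝒞 a := by
    conv_lhs => rw [← (equivFinsuppOfBasisRight (M := M) 𝒞).symm_apply_apply z,
      equivFinsuppOfBasisRight_symm_apply]
    rfl
  let Λ : Module.Dual k S →ₗ[k] M :=
    { toFun := fun φ => sliceRight M φ z
      map_add' := fun φ ψ => (by simp [sliceRight, LinearMap.lTensor_add])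
      map_smul' := fun c φ => (by simp [sliceRight, LinearMap.lTensor_smul]) }
  let W := LinearMap.range Λ
  have hW : W ≤ Submodule.span k (x.support.image x : Set M) := by
    rintro _ ⟨φ, rfl⟩
    change sliceRight M φ z ∈ _
    rw [hz, map_sum]
    refine Submodule.sum_mem _ fun a ha => ?_
    rw [sliceRight_tmul]
    exact Submodule.smul_mem _ _ (Submodule.subset_span
      (Finset.mem_coe.mpr (Finset.mem_image_of_mem x ha)))
  have _ : Module.Finite k W :=
    Submodule.finiteDimensional_of_le hW
  let 𝓔 := Module.finBasis k W
  choose φ hφ using fun j => (𝓔 j).2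
  have hxW (a) : x a ∈ W := ⟨𝒞.coord a, (hx a).symm⟩
  let E : (Fin (Module.finrank k W) → k) →ₗ[k] M := W.subtype ∘ₗ 𝓔.equivFun.symm.toLinearMap
  obtain ⟨g, hg⟩ := LinearMap.exists_leftInverse_of_injective E
    (LinearMap.ker_eq_bot.mpr (W.injective_subtype.comp 𝓔.equivFun.symm.injective))
  refine ⟨_, fun j => 𝓔 j, φ, fun l => ∑ a ∈ x.support, 𝓔.repr ⟨x a, hxW a⟩ l • 𝒞 a, g,
    fun j => ?_, fun j => (hφ j).symm, ?_⟩
  · have := LinearMap.congr_fun hg (Pi.single j 1)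
    simpa [E] using this
  · conv_lhs => rw [hz]
    simp only [tmul_sum, tmul_smul]
    rw [Finset.sum_comm]
    refine Finset.sum_congr rfl fun a _ => ?_
    have h := congrArg Subtype.val (𝓔.sum_repr ⟨x a, hxW a⟩)
    simp only [Submodule.coe_sum, Submodule.coe_smul] at h
    simp only [smul_tmul']
    rw [← TensorProduct.sum_tmul, h]

variable [CommRing S] [HopfAlgebra k S]

/-- An element of a comodule lies in a finite-dimensional subcomodule, spanned by
contractions of its coaction. -/
lemma exists_finite_subcomodule (δ : M →ₗ[k] M ⊗[k] S)
    (hcoassoc : ∀ m, TensorProduct.assoc k M S S (δ.rTensor S (δ m)) =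
      (Coalgebra.comul (R := k) (A := S)).lTensor M (δ m))
    (hcounit : ∀ m, sliceRight M (Coalgebra.counit (R := k) (A := S)) (δ m) = m) (r : M) :
    ∃ (N : ℕ) (e : Fin N → M) (φ : Fin N → Module.Dual k S) (c : Matrix (Fin N) (Fin N) S)
      (a : Fin N → k), (∀ j, e j = sliceRight M (φ j) (δ r)) ∧ r = ∑ j, a j • e j ∧
      (∀ j, δ (e j) = ∑ l, e l ⊗ₜ c l j) ∧
      (∀ i j, Coalgebra.comul (R := k) (c i j) = ∑ p, c i p ⊗ₜ[k] c p j) ∧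
      ∀ i j, Coalgebra.counit (R := k) (c i j) = (1 : Matrix _ _ k) i j := by
  obtain ⟨N, e, φ, t, g, hg, he, ht⟩ := exists_eq_sum_sliceRight_tmul (δ r)
  let Θ (j : Fin N) : S →ₗ[k] S := sliceRight S (φ j) ∘ₗ Coalgebra.comul
  have hΘ (j : Fin N) : δ (e j) = ∑ l, e l ⊗ₜ Θ j (t l) := by
    have h1 : ∀ u : (M ⊗[k] S) ⊗[k] S, sliceRight (M ⊗[k] S) (φ j) u =
        (sliceRight S (φ j)).lTensor M (TensorProduct.assoc k M S S u) := by
      intro u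
      induction u with
      | zero => simp
      | add x y hx hy => simp only [map_add, hx, hy]
      | tmul x s =>
        induction x with
        | zero => simp
        | add x y hx hy => simp only [map_add, hx, hy, add_tmul]
        | tmul m s' => simp
    rw [he j, comp_sliceRight, h1, hcoassoc, ht]
    simp [Θ]
  have hlin {Q : Type} [AddCommGroup Q] [Module k Q] {u v : Fin N → Q}
      (h : ∑ l, e l ⊗ₜ[k] u l = ∑ l, e l ⊗ₜ v l) (l : Fin N) : u l = v l := by
    have := congrArg (fun z => TensorProduct.lid k Q ((LinearMap.proj l ∘ₗ g).rTensor Q z)) h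
    simpa [hg, Pi.single_apply] using this
  refine ⟨N, e, φ, Matrix.of fun l j => Θ j (t l), fun l => Coalgebra.counit (R := k) (t l),
    he, ?_, hΘ, fun i j => ?_, fun i j => ?_⟩
  · conv_lhs => rw [← hcounit r, ht]
    simp
  · have h := hcoassoc (e j)
    rw [hΘ j] at h
    simp only [map_sum, LinearMap.rTensor_tmul, LinearMap.lTensor_tmul, hΘ, TensorProduct.sum_tmul,
      assoc_tmul] at h
    rw [Finset.sum_comm] at h
    simp only [← tmul_sum] at h
    exact (hlin h i).symm
  · have h := hcounit (e j)
    rw [hΘ j, map_sum] at h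
    simp only [sliceRight_tmul] at h
    have := congrFun (congrArg g h) i
    simpa [hg, Pi.single_apply, Finset.sum_apply, Matrix.one_apply] using this

end Slices

section DualRepresentation

variable {k : Type} [Field k] {S : Type} [CommRing S] [HopfAlgebra k S] {N : ℕ}

/-- The linear map `kᴺ → kᴺ ⊗ S` with matrix of coefficients `P`. -/
noncomputable def matrixCoaction (P : Matrix (Fin N) (Fin N) S) :
    (Fin N → k) →ₗ[k] (Fin N → k) ⊗[k] S :=
  Fintype.linearCombination k fun l => ∑ j, Pi.single j 1 ⊗ₜ[k] P j l

lemma matrixCoaction_single (P : Matrix (Fin N) (Fin N) S) (l : Fin N) :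
    matrixCoaction P (Pi.single l 1 : Fin N → k) = ∑ j, Pi.single j 1 ⊗ₜ[k] P j l := by
  rw [matrixCoaction, Fintype.linearCombination_apply_single, one_smul]

lemma matCoef_matrixCoaction (P : Matrix (Fin N) (Fin N) S) (i l : Fin N) :
    matCoef (k := k) (matrixCoaction P) (Pi.single l 1) i = P i l := by
  simp [matCoef, matrixCoaction_single, Pi.single_apply]

lemma isCoaction_matrixCoaction {P : Matrix (Fin N) (Fin N) S}
    (hΔ : ∀ i j, Coalgebra.comul (R := k) (P i j) = ∑ p, P i p ⊗ₜ[k] P p j)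
    (hε : ∀ i j, Coalgebra.counit (R := k) (P i j) = (1 : Matrix _ _ k) i j) :
    IsCoaction (k := k) (matrixCoaction P) := by
  constructor
  · intro v
    have h : (TensorProduct.rid k (Fin N → k)).toLinearMap ∘ₗ
        TensorProduct.map LinearMap.id (Coalgebra.counit (R := k) (A := S)) ∘ₗ
        matrixCoaction P = LinearMap.id := by
      refine (Pi.basisFun k (Fin N)).ext fun l => ?_
      simp [matrixCoaction_single, hε, Matrix.one_apply]
    exact LinearMap.congr_fun h v
  · intro v
    have h : (TensorProduct.assoc k (Fin N → k) S S).toLinearMap ∘ₗ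
        TensorProduct.map (matrixCoaction P) LinearMap.id ∘ₗ matrixCoaction P =
        TensorProduct.map LinearMap.id (Coalgebra.comul (R := k) (A := S)) ∘ₗ
        matrixCoaction P := by
      refine (Pi.basisFun k (Fin N)).ext fun l => ?_
      simp only [Pi.basisFun_apply, LinearMap.comp_apply, matrixCoaction_single, map_sum, map_tmul,
        LinearMap.id_apply, hΔ, TensorProduct.sum_tmul, tmul_sum, LinearEquiv.coe_coe, assoc_tmul]
      exact Finset.sum_comm
    exact LinearMap.congr_fun h v

variable {c : Matrix (Fin N) (Fin N) S}

lemma mul_map_antipode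
    (hΔ : ∀ i j, Coalgebra.comul (R := k) (c i j) = ∑ p, c i p ⊗ₜ[k] c p j)
    (hε : ∀ i j, Coalgebra.counit (R := k) (c i j) = (1 : Matrix _ _ k) i j) :
    c * c.map (HopfAlgebra.antipodeAlgHom k S) = 1 := by
  ext i j
  have h := HopfAlgebra.mul_antipode_lTensor_comul_apply (R := k) (c i j)
  rw [hΔ, hε] at h
  simpa [Matrix.mul_apply, Matrix.one_apply, apply_ite (algebraMap k S)] using h

lemma map_antipode_mul
    (hΔ : ∀ i j, Coalgebra.comul (R := k) (c i j) = ∑ p, c i p ⊗ₜ[k] c p j)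
    (hε : ∀ i j, Coalgebra.counit (R := k) (c i j) = (1 : Matrix _ _ k) i j) :
    c.map (HopfAlgebra.antipodeAlgHom k S) * c = 1 :=
  mul_eq_one_comm.mp (mul_map_antipode hΔ hε)

lemma comul_map_antipode
    (hΔ : ∀ i j, Coalgebra.comul (R := k) (c i j) = ∑ p, c i p ⊗ₜ[k] c p j)
    (hε : ∀ i j, Coalgebra.counit (R := k) (c i j) = (1 : Matrix _ _ k) i j) (i j : Fin N) :
    Coalgebra.comul (R := k) (c.map (HopfAlgebra.antipodeAlgHom k S) i j) =
      ∑ p, c.map (HopfAlgebra.antipodeAlgHom k S) p j ⊗ₜ[k]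
        c.map (HopfAlgebra.antipodeAlgHom k S) i p := by
  set d := c.map (HopfAlgebra.antipodeAlgHom k S) with hd
  let Δ : S →ₐ[k] S ⊗[k] S := Bialgebra.comulAlgHom k S
  let ιL : S →ₐ[k] S ⊗[k] S := Algebra.TensorProduct.includeLeft
  let ιR : S →ₐ[k] S ⊗[k] S := Algebra.TensorProduct.includeRight
  have hone (f : S →ₐ[k] S ⊗[k] S) {x y : Matrix (Fin N) (Fin N) S} (h : x * y = 1) :
      x.map f * y.map f = 1 := by
    rw [← Matrix.map_mul, h, Matrix.map_one _ (map_zero f) (map_one f)]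
  have hc : c.map Δ = c.map ιL * c.map ιR := by
    ext i j
    simpa [Matrix.mul_apply, Δ, ιL, ιR] using hΔ i j
  have hcd := mul_map_antipode hΔ hε
  rw [← hd] at hcd
  have h : d.map Δ = d.map ιR * d.map ιL := by
    refine left_inv_eq_right_inv (a := c.map Δ) (hone Δ (mul_eq_one_comm.mp hcd)) ?_
    rw [hc, mul_assoc, ← mul_assoc (c.map ιR), hone ιR hcd, one_mul, hone ιL hcd]
  have := congrFun (congrFun h i) j
  simpa [Matrix.mul_apply, Δ, ιL, ιR] using this

lemma counit_map_antipode
    (hΔ : ∀ i j, Coalgebra.comul (R := k) (c i j) = ∑ p, c i p ⊗ₜ[k] c p j)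
    (hε : ∀ i j, Coalgebra.counit (R := k) (c i j) = (1 : Matrix _ _ k) i j) (i j : Fin N) :
    Coalgebra.counit (R := k) (c.map (HopfAlgebra.antipodeAlgHom k S) i j) =
      (1 : Matrix _ _ k) i j := by
  have h : (c.map (HopfAlgebra.antipodeAlgHom k S)).map (Bialgebra.counitAlgHom k S) *
      c.map (Bialgebra.counitAlgHom k S) = 1 := by
    rw [← Matrix.map_mul, map_antipode_mul hΔ hε, Matrix.map_one _ (map_zero _) (map_one _)]
  have hc : c.map (Bialgebra.counitAlgHom k S) = 1 := by
    ext i j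
    exact hε i j
  rw [hc, mul_one] at h
  exact congrFun (congrFun h i) j

/-- Geometric reductivity applied to an invariant linear form on a finite-dimensional
comodule. -/
lemma IsReductive.exists_invariant_form (hS : IsReductive k S)
    (hΔ : ∀ i j, Coalgebra.comul (R := k) (c i j) = ∑ p, c i p ⊗ₜ[k] c p j)
    (hε : ∀ i j, Coalgebra.counit (R := k) (c i j) = (1 : Matrix _ _ k) i j)
    {v : Fin N → k} (hv : v ≠ 0)
    (hinv : ∀ j, ∑ l, v l • c l j = algebraMap k S (v j)) :
    ∃ (f : MvPolynomial (Fin N) k) (m : ℕ), 0 < m ∧ f.IsHomogeneous m ∧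
      MvPolynomial.aeval (fun j => ∑ l, MvPolynomial.X l ⊗ₜ[k]
        c.map (HopfAlgebra.antipodeAlgHom k S) l j) f = f ⊗ₜ[k] (1 : S) ∧
      MvPolynomial.eval v f ≠ 0 := by
  set d := c.map (HopfAlgebra.antipodeAlgHom k S) with hd
  let V : Fin N → S := fun j => algebraMap k S (v j)
  have hVc : Matrix.vecMul V c = V := by
    ext j
    simpa [Matrix.vecMul, dotProduct, Algebra.smul_def] using hinv j
  have hVd : Matrix.vecMul V d = V := by
    conv_lhs => rw [← hVc]
    rw [Matrix.vecMul_vecMul, mul_map_antipode hΔ hε, Matrix.vecMul_one]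
  have hfix : matrixCoaction d.transpose v = v ⊗ₜ[k] (1 : S) := by
    rw [matrixCoaction, Fintype.linearCombination_apply]
    simp only [Finset.smul_sum, ← tmul_smul, Matrix.transpose_apply]
    rw [Finset.sum_comm]
    simp only [← tmul_sum]
    have h (j : Fin N) : ∑ l, v l • d l j = v j • (1 : S) := by
      have := congrFun hVd j
      simpa [Matrix.vecMul, dotProduct, V, Algebra.smul_def] using this
    simp only [h, tmul_smul, smul_tmul']
    rw [← TensorProduct.sum_tmul]
    congr 1
    ext i
    simp [Finset.sum_apply, Pi.single_apply]
  obtain ⟨f, m, hm, hf, hfinv, hfv⟩ := hS.2.2 N (matrixCoaction d.transpose)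
    (isCoaction_matrixCoaction (fun i j => comul_map_antipode hΔ hε j i) (fun i j =>
      (counit_map_antipode hΔ hε j i).trans (by simp [Matrix.one_apply, eq_comm]))) v hv hfix
  refine ⟨f, m, hm, hf, ?_, hfv⟩
  rw [← hfinv, coactPoly]
  simp only [matCoef_matrixCoaction, Matrix.transpose_apply]

end DualRepresentation

section Nagata

variable {k : Type} [Field k] {R S : Type} [CommRing R] [Algebra k R] [CommRing S]

lemma rTensor_mulLeft_apply [Algebra k S] (a : R) (z : R ⊗[k] S) :
    (LinearMap.mulLeft k a).rTensor S z = a ⊗ₜ 1 * z := by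
  induction z with
  | zero => simp
  | add x y hx hy => rw [map_add, hx, hy, mul_add]
  | tmul x s => simp

variable [HopfAlgebra k S] {m : ℕ}

/-- The coaction on tuples induced by a coaction on `R`. -/
noncomputable def piCoaction (m : ℕ) (δ : R →ₗ[k] R ⊗[k] S) :
    (Fin m → R) →ₗ[k] (Fin m → R) ⊗[k] S :=
  ∑ i, (LinearMap.single k (fun _ : Fin m => R) i).rTensor S ∘ₗ δ ∘ₗ LinearMap.proj i

lemma piCoaction_apply (δ : R →ₗ[k] R ⊗[k] S) (x : Fin m → R) :
    piCoaction m δ x = ∑ i, (LinearMap.single k (fun _ : Fin m => R) i).rTensor S (δ (x i)) := by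
  simp [piCoaction]

lemma piCoaction_single (δ : R →ₗ[k] R ⊗[k] S) (i : Fin m) (x : R) :
    piCoaction m δ (Pi.single i x) =
      (LinearMap.single k (fun _ : Fin m => R) i).rTensor S (δ x) := by
  rw [piCoaction_apply, Finset.sum_eq_single i]
  · simp
  · intro j _ hj
    simp [hj]
  · simp

lemma rTensor_proj_piCoaction (δ : R →ₗ[k] R ⊗[k] S) (i : Fin m) (x : Fin m → R) :
    (LinearMap.proj (R := k) (φ := fun _ : Fin m => R) i).rTensor S (piCoaction m δ x) =
      δ (x i) := by
  rw [piCoaction_apply, map_sum, Finset.sum_eq_single i]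
  · rw [← LinearMap.rTensor_comp_apply, LinearMap.proj_comp_single_same, LinearMap.rTensor_id_apply]
  · intro j _ hj
    rw [← LinearMap.rTensor_comp_apply, LinearMap.proj_comp_single_ne _ _ _ _ hj.symm,
      LinearMap.rTensor_zero, LinearMap.zero_apply]
  · simp

/-- **Nagata's lemma**: if invariant elements generate the unit ideal of an algebra acted upon by
a geometrically reductive group, then there is a polynomial relation with invariant
coefficients witnessing this. -/
lemma IsReductive.exists_invariant_polynomial [Nontrivial R] (hS : IsReductive k S)
    (δ : R →ₐ[k] R ⊗[k] S)
    (hcoassoc : ∀ b, TensorProduct.assoc k R S S (δ.toLinearMap.rTensor S (δ b)) =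
      (Coalgebra.comul (R := k) (A := S)).lTensor R (δ b))
    (hcounit : ∀ b, sliceRight R (Coalgebra.counit (R := k) (A := S)) (δ b) = b)
    {f r : Fin m → R} (hf : ∀ i, δ (f i) = f i ⊗ₜ 1) (hfr : ∑ i, f i * r i = 1) :
    ∃ F : MvPolynomial (Fin m) R, (∀ α, δ (F.coeff α) = F.coeff α ⊗ₜ 1) ∧
      F.coeff 0 = 0 ∧ MvPolynomial.eval f F = 1 := by
  let δM := piCoaction m δ.toLinearMap
  obtain ⟨N, e, φ, c, a, he, hr, hδe, hΔ, hε⟩ := exists_finite_subcomodule (S := S) δM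
    (fun x => by
      have h : (TensorProduct.assoc k (Fin m → R) S S).toLinearMap ∘ₗ δM.rTensor S ∘ₗ δM =
          (Coalgebra.comul (R := k) (A := S)).lTensor (Fin m → R) ∘ₗ δM := by
        refine LinearMap.pi_ext' fun i => LinearMap.ext fun b => ?_
        let σ := LinearMap.single k (fun _ : Fin m => R) i
        have hσ : δM ∘ₗ σ = σ.rTensor S ∘ₗ δ.toLinearMap :=
          LinearMap.ext fun b => piCoaction_single _ i b
        have hassoc : (TensorProduct.assoc k (Fin m → R) S S).toLinearMap ∘ₗ
            (σ.rTensor S).rTensor S =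
            σ.rTensor (S ⊗[k] S) ∘ₗ (TensorProduct.assoc k R S S).toLinearMap :=
          TensorProduct.ext_threefold fun x s t => (by simp)
        calc TensorProduct.assoc k (Fin m → R) S S (δM.rTensor S ((δM ∘ₗ σ) b))
            = TensorProduct.assoc k (Fin m → R) S S
                ((σ.rTensor S ∘ₗ δ.toLinearMap).rTensor S (δ b)) := by
              rw [hσ, LinearMap.comp_apply, ← LinearMap.rTensor_comp_apply, hσ]
              rfl
          _ = σ.rTensor (S ⊗[k] S)
                (TensorProduct.assoc k R S S (δ.toLinearMap.rTensor S (δ b))) := by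
              rw [LinearMap.rTensor_comp_apply]
              exact LinearMap.congr_fun hassoc _
          _ = (Coalgebra.comul (R := k) (A := S)).lTensor (Fin m → R) ((δM ∘ₗ σ) b) := by
              rw [hcoassoc, hσ, LinearMap.comp_apply, ← LinearMap.comp_apply,
                LinearMap.rTensor_comp_lTensor, ← LinearMap.lTensor_comp_rTensor]
              rfl
      exact LinearMap.congr_fun h x)
    (fun x => by
      ext i
      have h := comp_sliceRight (LinearMap.proj (R := k) (φ := fun _ : Fin m => R) i)
        (Coalgebra.counit (R := k) (A := S)) (δM x)
      rw [rTensor_proj_piCoaction] at h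
      exact h.trans (hcounit (x i))) r
  let Λ : (Fin m → R) →ₗ[k] R := ∑ i, LinearMap.mulLeft k (f i) ∘ₗ LinearMap.proj i
  have hΛ (x : Fin m → R) : Λ x = ∑ i, f i * x i := by simp [Λ]
  have hΛδ (x : Fin m → R) : Λ.rTensor S (δM x) = δ (Λ x) := by
    have h (i : Fin m) : Λ ∘ₗ LinearMap.single k (fun _ : Fin m => R) i =
        LinearMap.mulLeft k (f i) := by
      ext x
      simp [hΛ, Pi.single_apply]
    simp only [δM, piCoaction_apply, map_sum, ← LinearMap.rTensor_comp_apply, h, hΛ, map_mul, hf]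
    exact Finset.sum_congr rfl fun i _ => rTensor_mulLeft_apply _ _
  let v : Fin N → k := fun j => φ j 1
  have hΛe (j : Fin N) : Λ (e j) = algebraMap k R (v j) := by
    rw [he j, comp_sliceRight, hΛδ, hΛ, hfr, map_one, Algebra.TensorProduct.one_def,
      sliceRight_tmul, Algebra.algebraMap_eq_smul_one]
  have hv : v ≠ 0 := by
    intro hv
    have h := hΛ r
    rw [hfr, hr, map_sum] at h
    simp [hΛe, hv] at h
  have hinv (j : Fin N) : ∑ l, v l • c l j = algebraMap k S (v j) := by
    apply Algebra.TensorProduct.includeRight_injective (R := k) (A := R) (B := S)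
      (FaithfulSMul.algebraMap_injective k R)
    have h := hΛδ (e j)
    simp only [δM, hδe, map_sum, LinearMap.rTensor_tmul, hΛe, AlgHom.commutes] at h
    simp only [map_sum, AlgHom.commutes, ← h, Algebra.TensorProduct.includeRight_apply]
    refine Finset.sum_congr rfl fun l _ => ?_
    rw [Algebra.algebraMap_eq_smul_one, smul_tmul]
  obtain ⟨g, d, hd, hg, hginv, hgv⟩ := hS.exists_invariant_form hΔ hε hv hinv
  let E : Fin N → MvPolynomial (Fin m) R := fun j => ∑ i, MvPolynomial.C (e j i) * .X i
  let F := MvPolynomial.aeval E g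
  let ι : R →ₐ[k] R ⊗[k] S := Algebra.TensorProduct.includeLeft
  have hEhom (j : Fin N) : (E j).IsHomogeneous 1 :=
    MvPolynomial.IsHomogeneous.sum _ _ _ fun i _ => MvPolynomial.isHomogeneous_C_mul_X _ _
  have hF0 : F.coeff 0 = 0 :=
    (hg.aeval E hEhom).coeff_eq_zero (by simpa using hd.ne)
  have hFeval : MvPolynomial.eval f F = algebraMap k R (MvPolynomial.eval v g) := by
    have hE : (fun j => MvPolynomial.aeval f (E j)) = fun j => algebraMap k R (v j) := by
      ext j
      rw [← hΛe, hΛ]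
      simp [E, mul_comm]
    have h := MvPolynomial.comp_aeval_apply (f := E)
      ((MvPolynomial.aeval f : MvPolynomial (Fin m) R →ₐ[R] R).restrictScalars k) g
    simp only [AlgHom.restrictScalars_apply] at h
    refine Eq.trans (h : MvPolynomial.eval f F = _) ?_
    rw [hE]
    exact MvPolynomial.aeval_algebraMap_apply R v g
  have hFinv : MvPolynomial.mapAlgHom δ F = MvPolynomial.mapAlgHom ι F := by
    let Ψ : MvPolynomial (Fin N) k ⊗[k] S →ₐ[k] MvPolynomial (Fin m) (R ⊗[k] S) :=
      Algebra.TensorProduct.lift (MvPolynomial.aeval fun l => MvPolynomial.mapAlgHom δ (E l))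
        ((IsScalarTower.toAlgHom k (R ⊗[k] S) (MvPolynomial (Fin m) (R ⊗[k] S))).comp
          Algebra.TensorProduct.includeRight) (fun _ _ => .all _ _)
    have h₁ : Ψ (g ⊗ₜ[k] (1 : S)) = MvPolynomial.mapAlgHom δ F := by
      rw [Algebra.TensorProduct.lift_tmul, map_one, mul_one, MvPolynomial.comp_aeval_apply]
    rw [← h₁, ← hginv, ← AlgHom.comp_apply, ← AlgHom.comp_apply]
    congr 1
    ext1 j
    set d' := c.map (HopfAlgebra.antipodeAlgHom k S) with hd'
    have hδe' (l : Fin N) (i : Fin m) : δ (e l i) = ∑ p, e p i ⊗ₜ c p l := by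
      refine (rTensor_proj_piCoaction δ.toLinearMap i (e l)).symm.trans ?_
      change (LinearMap.proj i).rTensor S (δM (e l)) = _
      simp [hδe]
    have hmap (ψ : R →ₐ[k] R ⊗[k] S) (l : Fin N) : MvPolynomial.mapAlgHom ψ (E l) =
        ∑ i, MvPolynomial.C (ψ (e l i)) * .X i := by
      simp [E]
    have hcd : c * d' = 1 := mul_map_antipode hΔ hε
    have hcd' (i : Fin m) :
        ∑ l, δ (e l i) * (1 ⊗ₜ[k] d' l j) = e j i ⊗ₜ[k] (1 : S) := by
      have h (p : Fin N) : ∑ l, c p l * d' l j = if p = j then 1 else 0 := by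
        rw [← Matrix.mul_apply, hcd, Matrix.one_apply]
      simp only [hδe', Finset.sum_mul, Algebra.TensorProduct.tmul_mul_tmul, mul_one]
      rw [Finset.sum_comm]
      simp only [← tmul_sum, h]
      rw [Finset.sum_eq_single j (fun p _ hp => by rw [if_neg hp, tmul_zero]) (by simp),
        if_pos rfl]
    simp only [AlgHom.comp_apply, MvPolynomial.aeval_X, map_sum, Ψ,
      Algebra.TensorProduct.lift_tmul, hmap, Algebra.TensorProduct.includeRight_apply,
      IsScalarTower.coe_toAlgHom', MvPolynomial.algebraMap_eq, Finset.sum_mul]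
    rw [Finset.sum_comm]
    refine Finset.sum_congr rfl fun i _ => ?_
    simp only [ι, Algebra.TensorProduct.includeLeft_apply, ← hcd' i, map_sum, map_mul,
      Finset.sum_mul]
    exact Finset.sum_congr rfl fun l _ => mul_right_comm _ _ _
  have hcoeff (α) : δ (F.coeff α) = F.coeff α ⊗ₜ 1 :=
    (MvPolynomial.coeff_map _ _ _).symm.trans
      ((congrArg (MvPolynomial.coeff α) hFinv).trans (MvPolynomial.coeff_map _ _ _))
  refine ⟨(MvPolynomial.eval v g)⁻¹ • F, fun α => ?_, ?_, ?_⟩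
  · rw [MvPolynomial.coeff_smul, map_smul, hcoeff, smul_tmul']
  · rw [MvPolynomial.coeff_smul, hF0, smul_zero]
  · rw [← algebraMap_smul R, MvPolynomial.smul_eval, hFeval, ← map_mul, inv_mul_cancel₀ hgv,
      map_one]

end Nagata

section PureCodimension

lemma exists_irreducible_dvd_mem {A : Type} [CommRing A] [IsDomain A]
    [UniqueFactorizationMonoid A] {P : Ideal A} [P.IsPrime] {q : A} (hq : q ≠ 0) (hqP : q ∈ P) :
    ∃ ϖ, Irreducible ϖ ∧ ϖ ∣ q ∧ ϖ ∈ P := by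
  obtain ⟨u, hu⟩ := UniqueFactorizationMonoid.factors_prod hq
  have h : (UniqueFactorizationMonoid.factors q).prod ∈ P :=
    (Ideal.mul_unit_mem_iff_mem P u.isUnit).mp (by rwa [hu])
  obtain ⟨ϖ, hϖ, hϖP⟩ := (Ideal.IsPrime.multiset_prod_mem_iff_exists_mem inferInstance _).mp h
  exact ⟨ϖ, UniqueFactorizationMonoid.irreducible_of_factor ϖ hϖ,
    UniqueFactorizationMonoid.dvd_of_mem_factors hϖ, hϖP⟩

lemma height_span_singleton_of_prime {A : Type} [CommRing A] [IsDomain A] [IsNoetherianRing A]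
    {ϖ : A} (hϖ : Prime ϖ) : (Ideal.span {ϖ}).height = 1 := by
  have hprime : (Ideal.span {ϖ}).IsPrime := (Ideal.span_singleton_prime hϖ.ne_zero).mpr hϖ
  refine le_antisymm (Ideal.height_le_one_of_isPrincipal_of_mem_minimalPrimes (Ideal.span {ϖ}) _
    (by simp [Ideal.minimalPrimes_eq_subsingleton_self])) (Order.one_le_iff_ne_zero.mpr ?_)
  rw [Ne, Ideal.height_eq_zero_iff_eq_bot, Ideal.span_singleton_eq_bot]
  exact hϖ.ne_zero

variable {A R : Type} [CommRing A] [IsDomain A] [UniqueFactorizationMonoid A] [CommRing R]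

/-- The denominator of a rational function that extends to `Spec R` vanishes only outside the
image of `Spec R`. -/
lemma zeroLocus_subset_compl_range_comap {φ : A →+* R}
    (hU : IsOpen (Set.range (PrimeSpectrum.comap φ))) {p q : A} {b : R} (hq : q ≠ 0)
    (hpq : IsRelPrime p q) (h : φ q * b = φ p) :
    PrimeSpectrum.zeroLocus {q} ⊆ (Set.range (PrimeSpectrum.comap φ))ᶜ := by
  intro x hx hxU
  obtain ⟨ϖ, hϖ, hϖq, hϖx⟩ := exists_irreducible_dvd_mem (P := x.asIdeal) hq (by simpa using hx)
  have hprime : (Ideal.span {ϖ}).IsPrime :=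
    (Ideal.span_singleton_prime hϖ.ne_zero).mpr hϖ.prime
  let η : PrimeSpectrum A := ⟨Ideal.span {ϖ}, hprime⟩
  have hηx : η ⤳ x := by
    rw [← PrimeSpectrum.le_iff_specializes]
    exact (Ideal.span_singleton_le_iff_mem _).mpr hϖx
  obtain ⟨Q, hQ⟩ := hηx.mem_open hU hxU
  have hmem (a : A) : φ a ∈ Q.asIdeal ↔ ϖ ∣ a := by
    rw [← Ideal.mem_span_singleton]
    exact (SetLike.ext_iff.mp (congrArg PrimeSpectrum.asIdeal hQ) a)
  refine hϖ.not_isUnit (hpq ((hmem p).mp ?_) hϖq)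
  rw [← h]
  exact Ideal.mul_mem_right _ _ ((hmem q).mpr hϖq)

/-- If every way of writing `1` as a combination of functions on `Spec A` comes from a polynomial
relation over rational functions on `Spec A`, then the complement of the open image of
`Spec R` has pure codimension one. -/
lemma pureCodimOne_compl_range_comap [IsNoetherianRing A] {φ : A →+* R}
    (hφ : Function.Injective φ) (hU : IsOpen (Set.range (PrimeSpectrum.comap φ)))
    (H : ∀ (m : ℕ) (f : Fin m → A) (r : Fin m → R), ∑ i, φ (f i) * r i = 1 →
      ∃ F : MvPolynomial (Fin m) R, F.coeff 0 = 0 ∧ MvPolynomial.eval (φ ∘ f) F = 1 ∧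
        ∀ α, ∃ p q : A, q ≠ 0 ∧ IsRelPrime p q ∧ φ q * F.coeff α = φ p) :
    PureCodimOne (Set.range (PrimeSpectrum.comap φ))ᶜ := by
  set C := (Set.range (PrimeSpectrum.comap φ))ᶜ with hC
  intro Z hZC hZmax
  let x := (PrimeSpectrum.pointsEquivIrreducibleCloseds A).symm (OrderDual.toDual Z)
  let I := PrimeSpectrum.vanishingIdeal C
  have hIC : PrimeSpectrum.zeroLocus (I : Set A) = C := by
    rw [PrimeSpectrum.zeroLocus_vanishingIdeal_eq_closure, hU.isClosed_compl.closure_eq]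
  have hxZ : OrderDual.ofDual (PrimeSpectrum.pointsEquivIrreducibleCloseds A x) = Z :=
    congrArg OrderDual.ofDual ((PrimeSpectrum.pointsEquivIrreducibleCloseds A).apply_symm_apply _)
  have hxC : x ∈ C := by
    apply hZC
    rw [← hxZ]
    exact subset_closure (Set.mem_singleton x)
  have hIR : I.map φ = ⊤ := by
    by_contra hne
    obtain ⟨M, hM, hle⟩ := Ideal.exists_le_maximal _ hne
    have hmem : PrimeSpectrum.comap φ ⟨M, hM.isPrime⟩ ∈ C := by
      rw [← hIC]
      exact Ideal.map_le_iff_le_comap.mp hle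
    exact hmem ⟨_, rfl⟩
  have h1 : (1 : R) ∈ Submodule.span R (φ '' I) := by
    change (1 : R) ∈ I.map φ
    rw [hIR]
    trivial
  obtain ⟨m, r, s, hrs⟩ := Submodule.mem_span_set'.mp h1
  choose f hfI hf using fun i => (s i).2
  obtain ⟨F, hF0, hF1, hFq⟩ := H m f r (by
    rw [← hrs]
    exact Finset.sum_congr rfl fun i _ => by rw [hf, smul_eq_mul, mul_comm])
  choose p q hq hpq hFpq using hFq
  have hx : ∃ α, q α ∈ x.asIdeal := by
    by_contra! hne
    have hdvd (α) (hα : α ∈ F.support) : ∃ p', φ (∏ β ∈ F.support, q β) * F.coeff α = φ p' := by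
      obtain ⟨c, hc⟩ := Finset.dvd_prod_of_mem q hα
      exact ⟨c * p α, by rw [hc, map_mul, map_mul, ← hFpq, mul_comm (φ (q α)), mul_assoc]⟩
    choose! p' hp' using hdvd
    have hsum : ∏ β ∈ F.support, q β = ∑ α ∈ F.support, p' α * ∏ i, f i ^ α i := by
      apply hφ
      rw [← mul_one (φ _), ← hF1, MvPolynomial.eval_eq', Finset.mul_sum, map_sum]
      refine Finset.sum_congr rfl fun α hα => ?_
      rw [← mul_assoc, hp' α hα]
      simp
    have hmem : ∏ β ∈ F.support, q β ∈ I := by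
      rw [hsum]
      refine I.sum_mem fun α hα => I.mul_mem_left _ ?_
      obtain ⟨i, hi⟩ : ∃ i, α i ≠ 0 := by
        by_contra! h0
        rw [show α = 0 from Finsupp.ext h0, MvPolynomial.mem_support_iff] at hα
        exact hα hF0
      exact I.mem_of_dvd (Finset.dvd_prod_of_mem (fun i => f i ^ α i) (Finset.mem_univ i))
        (I.pow_mem_of_mem (hfI i) _ (Nat.pos_of_ne_zero hi))
    have hxI : I ≤ x.asIdeal := by
      rw [← hIC] at hxC
      exact hxC
    obtain ⟨α, _, hα⟩ := (Ideal.IsPrime.prod_mem_iff (p := x.asIdeal)).mp (hxI hmem)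
    exact hne α hα
  obtain ⟨α, hα⟩ := hx
  obtain ⟨ϖ, hϖ, hϖq, hϖx⟩ := exists_irreducible_dvd_mem (hq α) hα
  have hprime : (Ideal.span {ϖ}).IsPrime :=
    (Ideal.span_singleton_prime hϖ.ne_zero).mpr hϖ.prime
  let η : PrimeSpectrum A := ⟨Ideal.span {ϖ}, hprime⟩
  let Z' := OrderDual.ofDual (PrimeSpectrum.pointsEquivIrreducibleCloseds A η)
  have hZ'C : Z'.carrier ⊆ C := by
    refine Set.Subset.trans ?_ (zeroLocus_subset_compl_range_comap hU (hq α) (hpq α) (hFpq α))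
    refine (PrimeSpectrum.isClosed_zeroLocus {q α}).closure_subset_iff.mpr ?_
    simpa [η, Ideal.mem_span_singleton] using hϖq
  have hηx : η ≤ x := (Ideal.span_singleton_le_iff_mem _).mpr hϖx
  have hZZ' : Z ≤ Z' := by
    rw [← hxZ]
    exact (PrimeSpectrum.pointsEquivIrreducibleCloseds A).monotone hηx
  rw [← hZmax Z' hZ'C hZZ', ← Order.height_toDual]
  change Order.height (PrimeSpectrum.pointsEquivIrreducibleCloseds A η) = 1
  rw [Order.height_orderIso, ← PrimeSpectrum.height_eq_orderHeight]
  exact height_span_singleton_of_prime hϖ.prime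

end PureCodimension

section Stabilizer

open WithConv

variable {k : Type} [Field k] {R : Type} [CommRing R] [HopfAlgebra k R] {n : ℕ}
  {S : Type} [CommRing S] [HopfAlgebra k S] {π : R →ₐ[k] S}

/-- The coaction on the coordinate ring of `G` given by right translation by a subgroup. -/
noncomputable def translation (π : R →ₐ[k] S) : R →ₐ[k] R ⊗[k] S :=
  (Algebra.TensorProduct.map (AlgHom.id k R) π).comp (Bialgebra.comulAlgHom k R)

lemma translation_apply (π : R →ₐ[k] S) (b : R) :
    translation π b = π.toLinearMap.lTensor R (Coalgebra.comul (R := k) b) := rfl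

lemma counit_comp_of_isHopfQuotient (hπ : IsHopfQuotient π) (x : R) :
    Coalgebra.counit (R := k) (π x) = Coalgebra.counit (R := k) x := by
  let g : WithConv (R →ₐ[k] k) := toConv ((Bialgebra.counitAlgHom k S).comp π)
  have hg : g * g = g := by
    refine congrArg toConv (AlgHom.ext fun x => ?_)
    have h := congrArg (Coalgebra.counit (R := k) (A := S))
      (congrArg (TensorProduct.rid k S) (Coalgebra.lTensor_counit_comul (R := k) (π x)))
    rw [hπ.2, TensorProduct.rid_tmul, one_smul] at h
    have hmap : LinearMap.mul' k k ∘ₗ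
        TensorProduct.map (Coalgebra.counit (R := k) (A := S) ∘ₗ π.toLinearMap)
          (Coalgebra.counit (R := k) (A := S) ∘ₗ π.toLinearMap) =
        Coalgebra.counit ∘ₗ (TensorProduct.rid k S).toLinearMap ∘ₗ
          (Coalgebra.counit (R := k) (A := S)).lTensor S ∘ₗ
          TensorProduct.map π.toLinearMap π.toLinearMap :=
      TensorProduct.ext' fun a b => (by simp [mul_comm])
    exact (LinearMap.congr_fun hmap (Coalgebra.comul x)).trans h
  have hone : g = 1 := mul_eq_left.mp hg
  exact DFunLike.congr_fun (congrArg ofConv hone) x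

lemma sliceRight_counit_translation (hπ : IsHopfQuotient π) (b : R) :
    sliceRight R (Coalgebra.counit (R := k) (A := S)) (translation π b) = b := by
  have h : Coalgebra.counit (R := k) (A := S) ∘ₗ π.toLinearMap = Coalgebra.counit :=
    LinearMap.ext (counit_comp_of_isHopfQuotient hπ)
  rw [translation_apply, sliceRight, LinearMap.comp_apply, ← LinearMap.lTensor_comp_apply, h,
    Coalgebra.lTensor_counit_comul]
  simp

lemma translation_coassoc (hπ : IsHopfQuotient π) (b : R) :
    TensorProduct.assoc k R S S ((translation π).toLinearMap.rTensor S (translation π b)) =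
      (Coalgebra.comul (R := k) (A := S)).lTensor R (translation π b) := by
  have hcomul : Coalgebra.comul (R := k) (A := S) ∘ₗ π.toLinearMap =
      TensorProduct.map π.toLinearMap π.toLinearMap ∘ₗ Coalgebra.comul :=
    LinearMap.ext hπ.2
  have hassoc : (TensorProduct.assoc k R S S).toLinearMap ∘ₗ
      TensorProduct.map (π.toLinearMap.lTensor R) π.toLinearMap =
      (TensorProduct.map π.toLinearMap π.toLinearMap).lTensor R ∘ₗ
        (TensorProduct.assoc k R R R).toLinearMap :=
    TensorProduct.ext_threefold fun x y z => (by simp)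
  have hδ : (translation π).toLinearMap.rTensor S ∘ₗ π.toLinearMap.lTensor R =
      TensorProduct.map (π.toLinearMap.lTensor R) π.toLinearMap ∘ₗ
        (Coalgebra.comul (R := k) (A := R)).rTensor R := by
    rw [LinearMap.rTensor_comp_lTensor, LinearMap.rTensor, ← TensorProduct.map_comp,
      LinearMap.comp_id]
    rfl
  rw [translation_apply, ← LinearMap.lTensor_comp_apply, hcomul, LinearMap.lTensor_comp_apply,
    ← Coalgebra.coassoc_apply, ← LinearMap.comp_apply, hδ]
  exact LinearMap.congr_fun hassoc _

lemma translation_orbitHom {ρ : (Fin n → k) →ₗ[k] (Fin n → k) ⊗[k] R} (hρ : IsCoaction ρ)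
    {w : Fin n → k} (hker : RingHom.ker π.toRingHom = stabIdeal ρ w)
    (a : MvPolynomial (Fin n) k) :
    translation π (orbitHom ρ w a) = orbitHom ρ w a ⊗ₜ[k] (1 : S) := by
  suffices h : (translation π).comp (orbitHom ρ w) =
      (Algebra.TensorProduct.includeLeft : R →ₐ[k] R ⊗[k] S).comp (orbitHom ρ w) from
    DFunLike.congr_fun h a
  ext i
  have hfix (j : Fin n) : π (matCoef ρ w j) = algebraMap k S (w j) := by
    have hmem : matCoef ρ w j - algebraMap k R (w j) ∈ RingHom.ker π.toRingHom := by
      rw [hker]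
      exact Ideal.subset_span ⟨j, rfl⟩
    have h : π (matCoef ρ w j - algebraMap k R (w j)) = 0 := hmem
    rwa [map_sub, AlgHom.commutes, sub_eq_zero] at h
  have h := Coalgebra.lTensor_counit_comul (R := k) (matCoef ρ w i)
  rw [comul_matCoef hρ] at h
  simp only [map_sum, LinearMap.lTensor_tmul, counit_matCoef hρ] at h
  have h' := congrArg (fun z => TensorProduct.rid k R z ⊗ₜ[k] (1 : S)) h
  simp only [map_sum, rid_tmul, one_smul, TensorProduct.sum_tmul] at h'
  simp only [AlgHom.comp_apply, orbitHom, MvPolynomial.aeval_X, translation_apply,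
    comul_matCoef hρ, map_sum, LinearMap.lTensor_tmul, AlgHom.toLinearMap_apply, hfix,
    Algebra.TensorProduct.includeLeft_apply, ← h']
  exact Finset.sum_congr rfl fun j _ => (by rw [Algebra.algebraMap_eq_smul_one, smul_tmul])

end Stabilizer

theorem complement_of_open_orbit_is_hypersurface
    (k : Type) [Field k] (R : Type) [CommRing R] [HopfAlgebra k R]
    (hG : IsReductive k R)
    (n : ℕ) (ρ : (Fin n → k) →ₗ[k] (Fin n → k) ⊗[k] R) (hρ : IsCoaction ρ)
    (w : Fin n → k)
    (hU : IsOpen (Set.range (orbitMap ρ w).base))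
    (S : Type) [CommRing S] [HopfAlgebra k S] (π : R →ₐ[k] S)
    (hπ : IsHopfQuotient π) (hker : RingHom.ker π.toRingHom = stabIdeal ρ w)
    (hstab : IsReductive k S) :
    (Set.range (orbitMap ρ w).base)ᶜ = ∅ ∨
      PureCodimOne (Set.range (orbitMap ρ w).base)ᶜ := by
  right
  change IsOpen (Set.range (PrimeSpectrum.comap (orbitHom ρ w).toRingHom)) at hU
  change PureCodimOne (Set.range (PrimeSpectrum.comap (orbitHom ρ w).toRingHom))ᶜ
  have hR : Nontrivial R := (Bialgebra.counitAlgHom k R).toRingHom.domain_nontrivial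
  obtain ⟨Q₀⟩ := (inferInstance : Nonempty (PrimeSpectrum R))
  have hspec : (⊥ : PrimeSpectrum (MvPolynomial (Fin n) k)) ⤳
      PrimeSpectrum.comap (orbitHom ρ w).toRingHom Q₀ :=
    (PrimeSpectrum.le_iff_specializes _ _).mp bot_le
  obtain ⟨Q, hQ⟩ := hspec.mem_open hU ⟨Q₀, rfl⟩
  have hmem (a : MvPolynomial (Fin n) k) (ha : orbitHom ρ w a ∈ Q.asIdeal) : a = 0 :=
    (SetLike.ext_iff.mp (congrArg PrimeSpectrum.asIdeal hQ) a).mp ha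
  let y : R →ₐ[k] FractionRing (R ⧸ Q.asIdeal) :=
    (IsScalarTower.toAlgHom k (R ⧸ Q.asIdeal) _).comp (Ideal.Quotient.mkₐ k Q.asIdeal)
  have hy : Function.Injective (y.comp (orbitHom ρ w)) := by
    rw [injective_iff_map_eq_zero]
    intro a ha
    refine hmem a (Ideal.Quotient.eq_zero_iff_mem.mp ?_)
    exact (map_eq_zero_iff _ (IsFractionRing.injective (R ⧸ Q.asIdeal)
      (FractionRing (R ⧸ Q.asIdeal)))).mp ha
  have hφ : Function.Injective (orbitHom ρ w) :=
    Function.Injective.of_comp (f := y) hy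
  refine pureCodimOne_compl_range_comap hφ hU fun m f r hfr => ?_
  obtain ⟨F, hF, hF0, hF1⟩ := hstab.exists_invariant_polynomial (translation π)
    (translation_coassoc hπ) (sliceRight_counit_translation hπ)
    (fun i => translation_orbitHom hρ hker (f i)) hfr
  exact ⟨F, hF0, hF1, fun α =>
    exists_orbitHom_mul_eq_of_invariant hρ y hy hπ.1 hker (hF α)⟩
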